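/- Let r ≥ 1, let S ⊆ ℤ^r be finite and let a : S → ℂ. Assume that for every c ∈ (ℂ*)^r and every nonzero v ∈ ℤ^r there are at least three integers d with Q_{a,v,d}(c) ≠ 0. Let I₀ ∈ S and t ∈ ℂ, and let a' be defined by a'(I₀) = t and a'(I) = a(I) for I ≠ I₀. Then for every c ∈ (ℂ*)^r and every nonzero v ∈ ℤ^r there are at least two integers d with Q_{a',v,d}(c) ≠ 0; consequently, neither Z(p_{a'}) nor (ℂ*)^r \ Z(p_{a'}) contains a coset of a one-dimensional subtorus. -/

import Mathlib

open scoped BigOperators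

noncomputable section

/-- The Laurent monomial `z^I = ∏ i, z i ^ (I i)` with integer exponents. -/
def lmon {r : ℕ} (z : Fin r → ℂ) (I : Fin r → ℤ) : ℂ :=
  ∏ i, z i ^ (I i)

/-- The Laurent polynomial `p_a(z) = Σ_{I ∈ S} a(I) z^I`. -/
def pa {r : ℕ} (S : Finset (Fin r → ℤ)) (a : (Fin r → ℤ) → ℂ) (z : Fin r → ℂ) : ℂ :=
  ∑ I ∈ S, a I * lmon z I

/-- The algebraic torus `(ℂ*)^r`, as a subset of `ℂ^r`. -/
def torus (r : ℕ) : Set (Fin r → ℂ) := {z | ∀ i, z i ≠ 0}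

/-- The zero set `Z(p_a) = {z ∈ (ℂ*)^r : p_a(z) = 0}`. -/
def Zset {r : ℕ} (S : Finset (Fin r → ℤ)) (a : (Fin r → ℤ) → ℂ) : Set (Fin r → ℂ) :=
  {z | (∀ i, z i ≠ 0) ∧ pa S a z = 0}

/-- The coset `C(c,v) = {(c_1 t^{v_1}, …, c_r t^{v_r}) : t ∈ ℂ*}` of a
one-dimensional subtorus (for `c ∈ (ℂ*)^r` and `v ∈ ℤ^r` nonzero). -/
def coset {r : ℕ} (c : Fin r → ℂ) (v : Fin r → ℤ) : Set (Fin r → ℂ) :=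
  {z | ∃ t : ℂ, t ≠ 0 ∧ z = fun i => c i * t ^ (v i)}

/-- The grouped coefficient `Q_{a,v,d}(c) = Σ_{I ∈ S, ⟨I,v⟩ = d} a(I) c^I`. -/
def Qc {r : ℕ} (S : Finset (Fin r → ℤ)) (a : (Fin r → ℤ) → ℂ) (v : Fin r → ℤ)
    (d : ℤ) (c : Fin r → ℂ) : ℂ :=
  ∑ I ∈ S.filter (fun I => (∑ i, I i * v i) = d), a I * lmon c I

/-- The Laurent monomial along a one-parameter coset. -/
lemma lmon_mul_zpow {r : ℕ} {s : ℂ} (hs : s ≠ 0) (c : Fin r → ℂ) (v I : Fin r → ℤ) :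
    lmon (fun i => c i * s ^ v i) I = lmon c I * s ^ (∑ i, I i * v i) := by
  have hsum : s ^ (∑ i, I i * v i) = ∏ i, s ^ (I i * v i) := by
    induction (Finset.univ : Finset (Fin r)) using Finset.induction_on with
    | empty => simp
    | insert i u hi ih => rw [Finset.sum_insert hi, Finset.prod_insert hi, zpow_add₀ hs, ih]
  rw [hsum, lmon, lmon, ← Finset.prod_mul_distrib]
  refine Finset.prod_congr rfl fun i _ => ?_
  rw [mul_zpow, ← zpow_mul, mul_comm (v i)]

/-- Restricted to a coset, a Laurent polynomial is the one-variable Laurent polynomial whose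
coefficients are the grouped coefficients. -/
lemma pa_coset {r : ℕ} (S : Finset (Fin r → ℤ)) (a : (Fin r → ℤ) → ℂ) {s : ℂ} (hs : s ≠ 0)
    (c : Fin r → ℂ) (v : Fin r → ℤ) :
    pa S a (fun i => c i * s ^ v i) =
      ∑ d ∈ S.image (fun I => ∑ i, I i * v i), Qc S a v d c * s ^ d := by
  rw [pa, ← Finset.sum_fiberwise_of_maps_to
    (fun I hI => Finset.mem_image_of_mem (fun I : Fin r → ℤ => ∑ i, I i * v i) hI)]
  refine Finset.sum_congr rfl fun d _ => ?_
  rw [Qc, Finset.sum_mul]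
  refine Finset.sum_congr rfl fun I hI => ?_
  rw [lmon_mul_zpow hs, (Finset.mem_filter.mp hI).2, mul_assoc]

lemma mem_image_of_Qc_ne_zero {r : ℕ} {S : Finset (Fin r → ℤ)} {a : (Fin r → ℤ) → ℂ}
    {v : Fin r → ℤ} {d : ℤ} {c : Fin r → ℂ} (h : Qc S a v d c ≠ 0) :
    d ∈ S.image (fun I => ∑ i, I i * v i) := by
  obtain ⟨I, hI, -⟩ := Finset.exists_ne_zero_of_sum_ne_zero h
  exact Finset.mem_image.mpr ⟨I, (Finset.mem_filter.mp hI).1, (Finset.mem_filter.mp hI).2⟩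

lemma finite_setOf_Qc_ne_zero {r : ℕ} (S : Finset (Fin r → ℤ)) (a : (Fin r → ℤ) → ℂ)
    (v : Fin r → ℤ) (c : Fin r → ℂ) : {d : ℤ | Qc S a v d c ≠ 0}.Finite := by
  refine (Finset.finite_toSet (S.image fun I => ∑ i, I i * v i)).subset fun d hd => ?_
  have hd' : Qc S a v d c ≠ 0 := hd
  exact Finset.mem_coe.mpr (mem_image_of_Qc_ne_zero hd')

/-- Changing one coefficient leaves all but one grouped coefficient unchanged. -/
lemma Qc_update_of_ne {r : ℕ} (S : Finset (Fin r → ℤ)) (a : (Fin r → ℤ) → ℂ)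
    (I₀ : Fin r → ℤ) (t : ℂ) (v : Fin r → ℤ) {d : ℤ} (c : Fin r → ℂ)
    (hd : d ≠ ∑ i, I₀ i * v i) :
    Qc S (Function.update a I₀ t) v d c = Qc S a v d c := by
  refine Finset.sum_congr rfl fun I hI => ?_
  have hne : I ≠ I₀ := by
    rintro rfl
    exact hd (Finset.mem_filter.mp hI).2.symm
  rw [Function.update_of_ne hne]

/-- A complex polynomial with two nonzero coefficients has a nonzero root. -/
lemma Polynomial.exists_ne_zero_eval_eq_zero {P : Polynomial ℂ} {m n : ℕ} (hmn : m ≠ n)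
    (hm : P.coeff m ≠ 0) (hn : P.coeff n ≠ 0) : ∃ s : ℂ, s ≠ 0 ∧ P.eval s = 0 := by
  have hP : P ≠ 0 := by
    rintro rfl
    exact hm (Polynomial.coeff_zero m)
  obtain ⟨R, hR, hdvd⟩ := P.exists_eq_pow_rootMultiplicity_mul_and_not_dvd hP 0
  rw [Polynomial.C_0, sub_zero] at hR hdvd
  have hdeg : R.degree ≠ 0 := by
    intro h
    rw [Polynomial.eq_C_of_degree_eq_zero h, mul_comm] at hR
    rw [hR, Polynomial.coeff_C_mul_X_pow] at hm hn
    exact hmn ((of_not_not fun h => hm (if_neg h)).trans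
      (of_not_not fun h => hn (if_neg h)).symm)
  obtain ⟨s, hs⟩ := IsAlgClosed.exists_root R hdeg
  refine ⟨s, ?_, ?_⟩
  · rintro rfl
    exact hdvd (Polynomial.X_dvd_iff.mpr (by rwa [Polynomial.coeff_zero_eq_eval_zero]))
  · rw [hR, Polynomial.eval_mul, hs.eq_zero, mul_zero]

/-- A nonzero complex polynomial is nonzero at some nonzero point. -/
lemma Polynomial.exists_ne_zero_eval_ne_zero {P : Polynomial ℂ} (hP : P ≠ 0) :
    ∃ s : ℂ, s ≠ 0 ∧ P.eval s ≠ 0 := by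
  by_contra! h
  refine mul_ne_zero Polynomial.X_ne_zero hP (Polynomial.funext fun s => ?_)
  rcases eq_or_ne s 0 with rfl | hs
  · simp
  · simp [h s hs]

/-- Up to a power of the variable, a one-variable Laurent polynomial is a polynomial. -/
lemma exists_polynomial_eval_eq (D : Finset ℤ) (q : ℤ → ℂ) :
    ∃ (N : ℤ) (P : Polynomial ℂ), (∀ d ∈ D, 0 ≤ d + N ∧ P.coeff (d + N).toNat = q d) ∧
      ∀ s : ℂ, s ≠ 0 → P.eval s = s ^ N * ∑ d ∈ D, q d * s ^ d := by
  have hN : ∀ d ∈ D, 0 ≤ d + ∑ e ∈ D, |e| := fun d hd => by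
    have := Finset.single_le_sum (f := fun e : ℤ => |e|) (fun e _ => abs_nonneg e) hd
    have := neg_abs_le d
    linarith
  refine ⟨∑ e ∈ D, |e|, ∑ d ∈ D, Polynomial.monomial (d + ∑ e ∈ D, |e|).toNat (q d),
    fun d hd => ⟨hN d hd, ?_⟩, fun s hs => ?_⟩
  · rw [Polynomial.finsetSum_coeff, Finset.sum_eq_single_of_mem d hd]
    · exact Polynomial.coeff_monomial_same _ _
    · intro e he hed
      have := hN d hd
      have := hN e he
      exact Polynomial.coeff_monomial_of_ne _ (by lia)
  · rw [Polynomial.eval_finsetSum, Finset.mul_sum]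
    refine Finset.sum_congr rfl fun d hd => ?_
    rw [Polynomial.eval_monomial, ← zpow_natCast, Int.toNat_of_nonneg (hN d hd), zpow_add₀ hs]
    ring

/-- If two grouped coefficients are nonzero then the Laurent polynomial both vanishes and
fails to vanish somewhere on the coset. -/
lemma exists_pa_coset_eq_zero_and_ne_zero {r : ℕ} {S : Finset (Fin r → ℤ)}
    {a : (Fin r → ℤ) → ℂ} {c : Fin r → ℂ} {v : Fin r → ℤ}
    (h : 2 ≤ {d : ℤ | Qc S a v d c ≠ 0}.ncard) :
    (∃ s : ℂ, s ≠ 0 ∧ pa S a (fun i => c i * s ^ v i) = 0) ∧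
      ∃ s : ℂ, s ≠ 0 ∧ pa S a (fun i => c i * s ^ v i) ≠ 0 := by
  obtain ⟨d, hd, e, he, hde⟩ := (Set.one_lt_ncard_iff_nontrivial_and_finite.mp h).1
  obtain ⟨N, P, hcoeff, heval⟩ := exists_polynomial_eval_eq
    (S.image fun I => ∑ i, I i * v i) (fun d => Qc S a v d c)
  obtain ⟨hd0, hdP⟩ := hcoeff d (mem_image_of_Qc_ne_zero hd)
  obtain ⟨he0, heP⟩ := hcoeff e (mem_image_of_Qc_ne_zero he)
  have hdP' : P.coeff (d + N).toNat ≠ 0 := hdP ▸ hd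
  have heP' : P.coeff (e + N).toNat ≠ 0 := heP ▸ he
  constructor
  · obtain ⟨s, hs, hPs⟩ := Polynomial.exists_ne_zero_eval_eq_zero (by lia) hdP' heP'
    rw [heval s hs, ← pa_coset S a hs] at hPs
    exact ⟨s, hs, (mul_eq_zero.mp hPs).resolve_left (zpow_ne_zero N hs)⟩
  · obtain ⟨s, hs, hPs⟩ := Polynomial.exists_ne_zero_eval_ne_zero
      (P := P) (fun h0 => hdP' (by rw [h0, Polynomial.coeff_zero]))
    rw [heval s hs, ← pa_coset S a hs] at hPs
    exact ⟨s, hs, right_ne_zero_of_mul hPs⟩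

/-- If for every `c ∈ (ℂ*)^r` and every nonzero `v ∈ ℤ^r` at least three integers `d`
satisfy `Q_{a,v,d}(c) ≠ 0`, then after replacing the single coefficient `a(I₀)` by any
`t ∈ ℂ`, at least two integers `d` satisfy `Q_{a',v,d}(c) ≠ 0`; consequently neither
`Z(p_{a'})` nor its complement in `(ℂ*)^r` contains a coset of a one-dimensional
subtorus. -/
theorem deformation_preserves_no_coset {r : ℕ} (hr : 1 ≤ r)
    (S : Finset (Fin r → ℤ)) (a : (Fin r → ℤ) → ℂ)
    (h3 : ∀ c : Fin r → ℂ, (∀ i, c i ≠ 0) → ∀ v : Fin r → ℤ, v ≠ 0 →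
      3 ≤ {d : ℤ | Qc S a v d c ≠ 0}.ncard)
    (I₀ : Fin r → ℤ) (hI₀ : I₀ ∈ S) (t : ℂ) :
    (∀ c : Fin r → ℂ, (∀ i, c i ≠ 0) → ∀ v : Fin r → ℤ, v ≠ 0 →
      2 ≤ {d : ℤ | Qc S (Function.update a I₀ t) v d c ≠ 0}.ncard) ∧
    (¬ ∃ c : Fin r → ℂ, ∃ v : Fin r → ℤ, (∀ i, c i ≠ 0) ∧ v ≠ 0 ∧
        coset c v ⊆ Zset S (Function.update a I₀ t)) ∧
    (¬ ∃ c : Fin r → ℂ, ∃ v : Fin r → ℤ, (∀ i, c i ≠ 0) ∧ v ≠ 0 ∧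
        coset c v ⊆ torus r \ Zset S (Function.update a I₀ t)) := by
  have h2 : ∀ c : Fin r → ℂ, (∀ i, c i ≠ 0) → ∀ v : Fin r → ℤ, v ≠ 0 →
      2 ≤ {d : ℤ | Qc S (Function.update a I₀ t) v d c ≠ 0}.ncard := by
    intro c hc v hv
    have hfin : {d : ℤ | Qc S (Function.update a I₀ t) v d c ≠ 0}.Finite :=
      finite_setOf_Qc_ne_zero S _ v c
    have hsub : {d : ℤ | Qc S a v d c ≠ 0} \ {∑ i, I₀ i * v i} ⊆
        {d : ℤ | Qc S (Function.update a I₀ t) v d c ≠ 0} := by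
      rintro d ⟨hd, hne⟩
      rwa [Set.mem_ofPred_eq, Qc_update_of_ne S a I₀ t v c hne]
    have hle := Set.ncard_le_ncard hsub hfin
    have hpred := Set.pred_ncard_le_ncard_sdiff_singleton
      {d : ℤ | Qc S a v d c ≠ 0} (∑ i, I₀ i * v i)
    have := h3 c hc v hv
    omega
  refine ⟨h2, ?_, ?_⟩
  · rintro ⟨c, v, hc, hv, hsub⟩
    obtain ⟨s, hs, hne⟩ := (exists_pa_coset_eq_zero_and_ne_zero (h2 c hc v hv)).2
    exact hne (hsub ⟨s, hs, rfl⟩).2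
  · rintro ⟨c, v, hc, hv, hsub⟩
    obtain ⟨s, hs, h0⟩ := (exists_pa_coset_eq_zero_and_ne_zero (h2 c hc v hv)).1
    have hmem := hsub ⟨s, hs, rfl⟩
    exact hmem.2 ⟨hmem.1, h0⟩
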